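/- Fix g > 0 and Δx, Δy > 0. In the setting of the previous cell-energy identity (five cells C, W, E, S, N with interface fluxes 𝓕_E, 𝓕_W, 𝓖_N, 𝓖_S satisfying the sufficient energy-conservation conditions, energy fluxes 𝓗, 𝓚, and source S_C), let Q_E, Q_W, Q_N, Q_S be symmetric positive semidefinite 3K×3K matrices, define the energy-stable fluxes 𝓕ᴱˢ = 𝓕 − ½Q⟦V⟧ at each east/west interface and 𝓖ᴱˢ = 𝓖 − ½Q⟦V⟧ at each north/south interface, and the energy-stable energy fluxes 𝓗ᴱˢ = 𝓗 − ½V̄·(Q⟦V⟧) and 𝓚ᴱˢ = 𝓚 − ½V̄·(Q⟦V⟧). Then V_C·(−(𝓕ᴱˢ_E − 𝓕ᴱˢ_W)/Δx − (𝓖ᴱˢ_N − 𝓖ᴱˢ_S)/Δy + S_C) = −(𝓗ᴱˢ_E − 𝓗ᴱˢ_W)/Δx − (𝓚ᴱˢ_N − 𝓚ᴱˢ_S)/Δy − (1/(4Δx))(⟦V⟧_Eᵀ Q_E ⟦V⟧_E + ⟦V⟧_Wᵀ Q_W ⟦V⟧_W) − (1/(4Δy))(⟦V⟧_Nᵀ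 Q_N ⟦V⟧_N + ⟦V⟧_Sᵀ Q_S ⟦V⟧_S), and in particular it is ≤ −(𝓗ᴱˢ_E − 𝓗ᴱˢ_W)/Δx − (𝓚ᴱˢ_N − 𝓚ᴱˢ_S)/Δy; i.e., the scheme is energy stable. -/

import Mathlib

open Matrix

/-- The Galerkin triple-product matrix `𝒫(a)`, defined by
`(𝒫(a))_{l,m} = ∑ k, a k * T k l m`. -/
noncomputable def Pmat {K : ℕ} (T : Fin K → Fin K → Fin K → ℝ) (a : Fin K → ℝ) :
    Matrix (Fin K) (Fin K) ℝ :=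
  Matrix.of fun l m => ∑ k, a k * T k l m

/-- A state `U = (h, qˣ, qʸ) ∈ ℝ^K × ℝ^K × ℝ^K`. -/
abbrev StateK (K : ℕ) := (Fin K → ℝ) × (Fin K → ℝ) × (Fin K → ℝ)

/-- Identification of a triple with a vector in `ℝ^{3K}`. -/
def toVec {K : ℕ} (a : StateK K) : Fin K ⊕ (Fin K ⊕ Fin K) → ℝ :=
  Sum.elim a.1 (Sum.elim a.2.1 a.2.2)

/-- Velocity coefficients `𝒫(h)⁻¹ q`. -/
noncomputable def uvel {K : ℕ} (T : Fin K → Fin K → Fin K → ℝ) (h q : Fin K → ℝ) :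
    Fin K → ℝ :=
  (Pmat T h)⁻¹ *ᵥ q

/-- The interface average `ā = (a_L + a_R)/2`. -/
noncomputable def avg {K : ℕ} (aL aR : Fin K → ℝ) : Fin K → ℝ :=
  (1 / 2 : ℝ) • (aL + aR)

/-- The entropy variable `V(U) = (−½𝒫(u)u − ½𝒫(v)v + g(h+B), u, v)`. -/
noncomputable def Vvar {K : ℕ} (T : Fin K → Fin K → Fin K → ℝ) (g : ℝ)
    (B : Fin K → ℝ) (U : StateK K) : StateK K :=
  (-(1 / 2 : ℝ) • (Pmat T (uvel T U.1 U.2.1) *ᵥ uvel T U.1 U.2.1)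
      - (1 / 2 : ℝ) • (Pmat T (uvel T U.1 U.2.2) *ᵥ uvel T U.1 U.2.2)
      + g • (U.1 + B),
   uvel T U.1 U.2.1, uvel T U.1 U.2.2)

/-- The energy potential `Ψ(U) = ½g uᵀ𝒫(h)h`. -/
noncomputable def Psi {K : ℕ} (T : Fin K → Fin K → Fin K → ℝ) (g : ℝ)
    (U : StateK K) : ℝ :=
  (1 / 2) * g * (uvel T U.1 U.2.1 ⬝ᵥ (Pmat T U.1 *ᵥ U.1))

/-- The energy potential `Φ(U) = ½g vᵀ𝒫(h)h`. -/
noncomputable def Phi {K : ℕ} (T : Fin K → Fin K → Fin K → ℝ) (g : ℝ)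
    (U : StateK K) : ℝ :=
  (1 / 2) * g * (uvel T U.1 U.2.2 ⬝ᵥ (Pmat T U.1 *ᵥ U.1))

/-- Sufficient energy-conservation condition for an x-direction flux (vector form). -/
def suffCondF {K : ℕ} (T : Fin K → Fin K → Fin K → ℝ) (g : ℝ)
    (BL BR : Fin K → ℝ) (UL UR : StateK K)
    (F : Fin K ⊕ (Fin K ⊕ Fin K) → ℝ) : Prop :=
  toVec (Vvar T g BR UR - Vvar T g BL UL) ⬝ᵥ F
    = Psi T g UR - Psi T g UL
      + g * ((BR - BL) ⬝ᵥ (Pmat T (avg UL.1 UR.1)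
          *ᵥ avg (uvel T UL.1 UL.2.1) (uvel T UR.1 UR.2.1)))

/-- Sufficient energy-conservation condition for a y-direction flux (vector form). -/
def suffCondG {K : ℕ} (T : Fin K → Fin K → Fin K → ℝ) (g : ℝ)
    (BL BR : Fin K → ℝ) (UL UR : StateK K)
    (G : Fin K ⊕ (Fin K ⊕ Fin K) → ℝ) : Prop :=
  toVec (Vvar T g BR UR - Vvar T g BL UL) ⬝ᵥ G
    = Phi T g UR - Phi T g UL
      + g * ((BR - BL) ⬝ᵥ (Pmat T (avg UL.1 UR.1)
          *ᵥ avg (uvel T UL.1 UL.2.2) (uvel T UR.1 UR.2.2)))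

/-- Numerical energy flux `𝓗 = V̄·𝓕 − Ψ̄ − (g/4)⟦B⟧ᵀ𝒫(h̄)⟦u⟧` (vector form). -/
noncomputable def Hnum {K : ℕ} (T : Fin K → Fin K → Fin K → ℝ) (g : ℝ)
    (BL BR : Fin K → ℝ) (UL UR : StateK K)
    (F : Fin K ⊕ (Fin K ⊕ Fin K) → ℝ) : ℝ :=
  toVec ((1 / 2 : ℝ) • (Vvar T g BL UL + Vvar T g BR UR)) ⬝ᵥ F
    - (1 / 2) * (Psi T g UL + Psi T g UR)
    - (g / 4) * ((BR - BL) ⬝ᵥ (Pmat T (avg UL.1 UR.1)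
        *ᵥ (uvel T UR.1 UR.2.1 - uvel T UL.1 UL.2.1)))

/-- Numerical energy flux `𝓚 = V̄·𝓖 − Φ̄ − (g/4)⟦B⟧ᵀ𝒫(h̄)⟦v⟧` (vector form). -/
noncomputable def Knum {K : ℕ} (T : Fin K → Fin K → Fin K → ℝ) (g : ℝ)
    (BL BR : Fin K → ℝ) (UL UR : StateK K)
    (G : Fin K ⊕ (Fin K ⊕ Fin K) → ℝ) : ℝ :=
  toVec ((1 / 2 : ℝ) • (Vvar T g BL UL + Vvar T g BR UR)) ⬝ᵥ G
    - (1 / 2) * (Phi T g UL + Phi T g UR)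
    - (g / 4) * ((BR - BL) ⬝ᵥ (Pmat T (avg UL.1 UR.1)
        *ᵥ (uvel T UR.1 UR.2.2 - uvel T UL.1 UL.2.2)))

theorem toVec_add {K : ℕ} (a b : StateK K) : toVec (a + b) = toVec a + toVec b := by
  ext (i | i | i) <;> rfl

theorem toVec_sub {K : ℕ} (a b : StateK K) : toVec (a - b) = toVec a - toVec b := by
  ext (i | i | i) <;> rfl

theorem toVec_smul {K : ℕ} (c : ℝ) (a : StateK K) : toVec (c • a) = c • toVec a := by
  ext (i | i | i) <;> rfl

theorem toVec_dotProduct_toVec {K : ℕ} (a b : StateK K) :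
    toVec a ⬝ᵥ toVec b = a.1 ⬝ᵥ b.1 + (a.2.1 ⬝ᵥ b.2.1 + a.2.2 ⬝ᵥ b.2.2) := by
  simp [toVec, dotProduct, Fintype.sum_sum_type]

/-- `𝒫(a)` is symmetric, as a bilinear form, when `T` is symmetric in its last two indices. -/
theorem dotProduct_Pmat_mulVec_comm {K : ℕ} {T : Fin K → Fin K → Fin K → ℝ}
    (hT : ∀ k l m, T k l m = T k m l) (a x y : Fin K → ℝ) :
    x ⬝ᵥ (Pmat T a *ᵥ y) = y ⬝ᵥ (Pmat T a *ᵥ x) := by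
  have h : (Pmat T a)ᵀ = Pmat T a := by
    ext l m
    simp only [Pmat, transpose_apply, of_apply, hT _ m l]
  rw [dotProduct_mulVec, ← mulVec_transpose, h, dotProduct_comm]

/-- The x-direction flux tested against the entropy variables on the two sides of the interface. -/
theorem suffCondF.dotProduct_eq {K : ℕ} {T : Fin K → Fin K → Fin K → ℝ}
    (hT : ∀ k l m, T k l m = T k m l) {g : ℝ} {BL BR : Fin K → ℝ} {UL UR : StateK K}
    {F : Fin K ⊕ (Fin K ⊕ Fin K) → ℝ} (h : suffCondF T g BL BR UL UR F) :
    toVec (Vvar T g BL UL) ⬝ᵥ F = Hnum T g BL BR UL UR F + Psi T g UL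
        - g / 2 * (uvel T UL.1 UL.2.1 ⬝ᵥ (Pmat T (avg UL.1 UR.1) *ᵥ (BR - BL)))
      ∧ toVec (Vvar T g BR UR) ⬝ᵥ F = Hnum T g BL BR UL UR F + Psi T g UR
        + g / 2 * (uvel T UR.1 UR.2.1 ⬝ᵥ (Pmat T (avg UL.1 UR.1) *ᵥ (BR - BL))) := by
  rw [dotProduct_Pmat_mulVec_comm hT _ (uvel T UL.1 UL.2.1),
    dotProduct_Pmat_mulVec_comm hT _ (uvel T UR.1 UR.2.1)]
  unfold suffCondF at h
  unfold Hnum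
  rw [avg.eq_1 (uvel T UL.1 UL.2.1)] at h
  simp only [toVec_sub, toVec_add, toVec_smul, sub_dotProduct, add_dotProduct, smul_dotProduct,
    mulVec_sub, mulVec_add, mulVec_smul, dotProduct_sub, dotProduct_add, dotProduct_smul,
    smul_eq_mul] at h ⊢
  constructor <;> linarith

/-- The y-direction flux tested against the entropy variables on the two sides of the interface. -/
theorem suffCondG.dotProduct_eq {K : ℕ} {T : Fin K → Fin K → Fin K → ℝ}
    (hT : ∀ k l m, T k l m = T k m l) {g : ℝ} {BL BR : Fin K → ℝ} {UL UR : StateK K}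
    {F : Fin K ⊕ (Fin K ⊕ Fin K) → ℝ} (h : suffCondG T g BL BR UL UR F) :
    toVec (Vvar T g BL UL) ⬝ᵥ F = Knum T g BL BR UL UR F + Phi T g UL
        - g / 2 * (uvel T UL.1 UL.2.2 ⬝ᵥ (Pmat T (avg UL.1 UR.1) *ᵥ (BR - BL)))
      ∧ toVec (Vvar T g BR UR) ⬝ᵥ F = Knum T g BL BR UL UR F + Phi T g UR
        + g / 2 * (uvel T UR.1 UR.2.2 ⬝ᵥ (Pmat T (avg UL.1 UR.1) *ᵥ (BR - BL))) := by
  rw [dotProduct_Pmat_mulVec_comm hT _ (uvel T UL.1 UL.2.2),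
    dotProduct_Pmat_mulVec_comm hT _ (uvel T UR.1 UR.2.2)]
  unfold suffCondG at h
  unfold Knum
  rw [avg.eq_1 (uvel T UL.1 UL.2.2)] at h
  simp only [toVec_sub, toVec_add, toVec_smul, sub_dotProduct, add_dotProduct, smul_dotProduct,
    mulVec_sub, mulVec_add, mulVec_smul, dotProduct_sub, dotProduct_add, dotProduct_smul,
    smul_eq_mul] at h ⊢
  constructor <;> linarith

/-- adding positive semidefinite diffusion on the jumps of the entropy
variable yields an energy-stable scheme: the cell energy production equals the
difference of the energy-stable energy fluxes minus nonnegative dissipation terms,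
and in particular is bounded above by the flux difference alone. -/
theorem es_scheme_cell_energy_estimate {K : ℕ} (hK : 1 ≤ K)
    (T : Fin K → Fin K → Fin K → ℝ)
    (hT1 : ∀ k l m, T k l m = T l k m) (hT2 : ∀ k l m, T k l m = T k m l)
    (g Δx Δy : ℝ) (hg : 0 < g) (hΔx : 0 < Δx) (hΔy : 0 < Δy)
    (UC UW UE US UN : StateK K) (BC BW BE BS BN : Fin K → ℝ)
    (invC : IsUnit (Pmat T UC.1)) (invW : IsUnit (Pmat T UW.1))
    (invE : IsUnit (Pmat T UE.1)) (invS : IsUnit (Pmat T US.1))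
    (invN : IsUnit (Pmat T UN.1))
    (FE FW GN GS : Fin K ⊕ (Fin K ⊕ Fin K) → ℝ)
    (hFE : suffCondF T g BC BE UC UE FE)
    (hFW : suffCondF T g BW BC UW UC FW)
    (hGN : suffCondG T g BC BN UC UN GN)
    (hGS : suffCondG T g BS BC US UC GS)
    (QE QW QN QS : Matrix (Fin K ⊕ (Fin K ⊕ Fin K)) (Fin K ⊕ (Fin K ⊕ Fin K)) ℝ)
    (hQE : QE.PosSemidef) (hQW : QW.PosSemidef)
    (hQN : QN.PosSemidef) (hQS : QS.PosSemidef) :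
    let jE := toVec (Vvar T g BE UE - Vvar T g BC UC)
    let jW := toVec (Vvar T g BC UC - Vvar T g BW UW)
    let jN := toVec (Vvar T g BN UN - Vvar T g BC UC)
    let jS := toVec (Vvar T g BC UC - Vvar T g BS US)
    let FESE := FE - (1 / 2 : ℝ) • (QE *ᵥ jE)
    let FESW := FW - (1 / 2 : ℝ) • (QW *ᵥ jW)
    let GESN := GN - (1 / 2 : ℝ) • (QN *ᵥ jN)
    let GESS := GS - (1 / 2 : ℝ) • (QS *ᵥ jS)
    let HESE := Hnum T g BC BE UC UE FE
      - (1 / 2) * (toVec ((1 / 2 : ℝ) • (Vvar T g BC UC + Vvar T g BE UE)) ⬝ᵥ (QE *ᵥ jE))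
    let HESW := Hnum T g BW BC UW UC FW
      - (1 / 2) * (toVec ((1 / 2 : ℝ) • (Vvar T g BW UW + Vvar T g BC UC)) ⬝ᵥ (QW *ᵥ jW))
    let KESN := Knum T g BC BN UC UN GN
      - (1 / 2) * (toVec ((1 / 2 : ℝ) • (Vvar T g BC UC + Vvar T g BN UN)) ⬝ᵥ (QN *ᵥ jN))
    let KESS := Knum T g BS BC US UC GS
      - (1 / 2) * (toVec ((1 / 2 : ℝ) • (Vvar T g BS US + Vvar T g BC UC)) ⬝ᵥ (QS *ᵥ jS))
    let SC : Fin K ⊕ (Fin K ⊕ Fin K) → ℝ := toVec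
      ((0 : Fin K → ℝ),
       -(g / (2 * Δx)) • (Pmat T (avg UC.1 UE.1) *ᵥ (BE - BC)
          + Pmat T (avg UW.1 UC.1) *ᵥ (BC - BW)),
       -(g / (2 * Δy)) • (Pmat T (avg UC.1 UN.1) *ᵥ (BN - BC)
          + Pmat T (avg US.1 UC.1) *ᵥ (BC - BS)))
    let prod := toVec (Vvar T g BC UC) ⬝ᵥ
      (-(1 / Δx) • (FESE - FESW) - (1 / Δy) • (GESN - GESS) + SC)
    (prod = -(1 / Δx) * (HESE - HESW) - (1 / Δy) * (KESN - KESS)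
        - (1 / (4 * Δx)) * (jE ⬝ᵥ (QE *ᵥ jE) + jW ⬝ᵥ (QW *ᵥ jW))
        - (1 / (4 * Δy)) * (jN ⬝ᵥ (QN *ᵥ jN) + jS ⬝ᵥ (QS *ᵥ jS)))
      ∧ prod ≤ -(1 / Δx) * (HESE - HESW) - (1 / Δy) * (KESN - KESS) := by
  intro jE jW jN jS FESE FESW GESN GESS HESE HESW KESN KESS SC prod
  have key : prod = -(1 / Δx) * (HESE - HESW) - (1 / Δy) * (KESN - KESS)
      - (1 / (4 * Δx)) * (jE ⬝ᵥ (QE *ᵥ jE) + jW ⬝ᵥ (QW *ᵥ jW))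
      - (1 / (4 * Δy)) * (jN ⬝ᵥ (QN *ᵥ jN) + jS ⬝ᵥ (QS *ᵥ jS)) := by
    have hE := (hFE.dotProduct_eq hT2).1
    have hW := (hFW.dotProduct_eq hT2).2
    have hN := (hGN.dotProduct_eq hT2).1
    have hS := (hGS.dotProduct_eq hT2).2
    have left (VC V : StateK K) (w : Fin K ⊕ (Fin K ⊕ Fin K) → ℝ) :
        toVec VC ⬝ᵥ w = toVec ((1 / 2 : ℝ) • (VC + V)) ⬝ᵥ w
          - 1 / 2 * (toVec (V - VC) ⬝ᵥ w) := by
      simp only [toVec_sub, toVec_add, toVec_smul, sub_dotProduct, add_dotProduct,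
        smul_dotProduct, smul_eq_mul]
      ring
    have right (VC V : StateK K) (w : Fin K ⊕ (Fin K ⊕ Fin K) → ℝ) :
        toVec VC ⬝ᵥ w = toVec ((1 / 2 : ℝ) • (V + VC)) ⬝ᵥ w
          + 1 / 2 * (toVec (VC - V) ⬝ᵥ w) := by
      simp only [toVec_sub, toVec_add, toVec_smul, sub_dotProduct, add_dotProduct,
        smul_dotProduct, smul_eq_mul]
      ring
    have dE := left (Vvar T g BC UC) (Vvar T g BE UE) (QE *ᵥ jE)
    have dW := right (Vvar T g BC UC) (Vvar T g BW UW) (QW *ᵥ jW)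
    have dN := left (Vvar T g BC UC) (Vvar T g BN UN) (QN *ᵥ jN)
    have dS := right (Vvar T g BC UC) (Vvar T g BS US) (QS *ᵥ jS)
    have hSC : toVec (Vvar T g BC UC) ⬝ᵥ SC =
        -(g / (2 * Δx)) * (uvel T UC.1 UC.2.1 ⬝ᵥ (Pmat T (avg UC.1 UE.1) *ᵥ (BE - BC))
            + uvel T UC.1 UC.2.1 ⬝ᵥ (Pmat T (avg UW.1 UC.1) *ᵥ (BC - BW)))
          + -(g / (2 * Δy)) * (uvel T UC.1 UC.2.2 ⬝ᵥ (Pmat T (avg UC.1 UN.1) *ᵥ (BN - BC))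
            + uvel T UC.1 UC.2.2 ⬝ᵥ (Pmat T (avg US.1 UC.1) *ᵥ (BC - BS))) := by
      simp only [SC, toVec_dotProduct_toVec, dotProduct_zero, zero_add, dotProduct_smul,
        dotProduct_add, smul_eq_mul, Vvar]
    simp only [prod, FESE, FESW, GESN, GESS, dotProduct_add, dotProduct_sub, dotProduct_smul,
      smul_eq_mul, hSC, hE, hW, hN, hS, dE, dW, dN, dS]
    simp only [HESE, HESW, KESN, KESS]
    simp only [jE, jW, jN, jS]
    field_simp
    ring
  refine ⟨key, ?_⟩
  have nonneg {Q : Matrix (Fin K ⊕ (Fin K ⊕ Fin K)) (Fin K ⊕ (Fin K ⊕ Fin K)) ℝ}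
      (hQ : Q.PosSemidef) (j : Fin K ⊕ (Fin K ⊕ Fin K) → ℝ) : 0 ≤ j ⬝ᵥ (Q *ᵥ j) := by
    simpa using hQ.dotProduct_mulVec_nonneg j
  have hx : 0 ≤ (1 / (4 * Δx)) * (jE ⬝ᵥ (QE *ᵥ jE) + jW ⬝ᵥ (QW *ᵥ jW)) :=
    mul_nonneg (by positivity) (add_nonneg (nonneg hQE jE) (nonneg hQW jW))
  have hy : 0 ≤ (1 / (4 * Δy)) * (jN ⬝ᵥ (QN *ᵥ jN) + jS ⬝ᵥ (QS *ᵥ jS)) :=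
    mul_nonneg (by positivity) (add_nonneg (nonneg hQN jN) (nonneg hQS jS))
  linarith
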